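/- arXiv:1107.4702 — 3 statements merged into one kernel-verified Lean document; each statement's English description precedes it below -/
import Mathlib

section
/- Let X and Y be finite types. The ℚ-linear isomorphism 𝕆(X ⊕ Y) ≅ 𝕆(X) ⊗[ℚ] 𝕆(Y) induced by the canonical bijection ((X ⊕ Y) → ℤˣ) ≃ (X → ℤˣ) × (Y → ℤˣ) respects the mod-4 gradings: for all i, j ∈ ℤ/4ℤ, the image of 𝕆_i(X) ⊗ 𝕆_j(Y) under (the inverse of) this isomorphism is contained in 𝕆_{i+j}(X ⊕ Y). -/
open TensorProduct

/-- The reversal involution `R_X` on the orientation space `𝕆(X) = (X → ℤˣ) →₀ ℚ`,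
induced by pointwise negation of orientations. -/
noncomputable def orientationReversal (X : Type) :
    ((X → ℤˣ) →₀ ℚ) →ₗ[ℚ] ((X → ℤˣ) →₀ ℚ) :=
  Finsupp.lmapDomain ℚ ℚ (fun o => -o)

/-- The `+1`-eigenspace of the reversal involution. -/
noncomputable def posEigenspace (X : Type) : Submodule ℚ ((X → ℤˣ) →₀ ℚ) :=
  LinearMap.ker (orientationReversal X - LinearMap.id)

/-- The `-1`-eigenspace of the reversal involution. -/
noncomputable def negEigenspace (X : Type) : Submodule ℚ ((X → ℤˣ) →₀ ℚ) :=
  LinearMap.ker (orientationReversal X + LinearMap.id)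

/-- The mod-4 grading on `𝕆(X)`: the piece `𝕆_k(X)` is the `+1`-eigenspace of the
reversal if `k ≡ -|X| (mod 4)`, the `-1`-eigenspace if `k ≡ 2 - |X| (mod 4)`, and
zero otherwise. -/
noncomputable def gradedPiece (X : Type) [Fintype X] (k : ZMod 4) :
    Submodule ℚ ((X → ℤˣ) →₀ ℚ) :=
  if k = -(Fintype.card X : ZMod 4) then posEigenspace X
  else if k = 2 - (Fintype.card X : ZMod 4) then negEigenspace X
  else ⊥

/-- The canonical isomorphism `𝕆(X ⊕ Y) ≅ 𝕆(X) ⊗[ℚ] 𝕆(Y)` induced by the bijection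
`((X ⊕ Y) → ℤˣ) ≃ (X → ℤˣ) × (Y → ℤˣ)`. -/
noncomputable def orientationTensorIso (X Y : Type) :
    ((X ⊕ Y → ℤˣ) →₀ ℚ) ≃ₗ[ℚ] ((X → ℤˣ) →₀ ℚ) ⊗[ℚ] ((Y → ℤˣ) →₀ ℚ) :=
  (Finsupp.domLCongr (Equiv.sumArrowEquivProdArrow X Y ℤˣ)).trans
    (finsuppTensorFinsupp' ℚ (X → ℤˣ) (Y → ℤˣ)).symm

theorem orientationReversal_tensorIso_symm (X Y : Type)
    (x : (X → ℤˣ) →₀ ℚ) (y : (Y → ℤˣ) →₀ ℚ) :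
    orientationReversal (X ⊕ Y) ((orientationTensorIso X Y).symm (x ⊗ₜ[ℚ] y)) =
      (orientationTensorIso X Y).symm (orientationReversal X x ⊗ₜ[ℚ] orientationReversal Y y) := by
  induction x using Finsupp.induction_linear with
  | zero => simp
  | add x₁ x₂ h₁ h₂ => simp [TensorProduct.add_tmul, h₁, h₂]
  | single a r =>
    induction y using Finsupp.induction_linear with
    | zero => simp
    | add y₁ y₂ h₁ h₂ => simp [TensorProduct.tmul_add, h₁, h₂]
    | single b s =>
      have h : -(Sum.elim a b) = Sum.elim (-a) (-b) := by
        ext (i | i) <;> rfl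
      simp [orientationTensorIso, orientationReversal, Finsupp.lmapDomain_apply,
        Finsupp.mapDomain_single, Finsupp.domLCongr_symm, Equiv.sumArrowEquivProdArrow, h, -Finsupp.single_mul]

theorem mem_posEigenspace {X : Type} {x : (X → ℤˣ) →₀ ℚ} :
    x ∈ posEigenspace X ↔ orientationReversal X x = x := by
  simp [posEigenspace, sub_eq_zero]

theorem mem_negEigenspace {X : Type} {x : (X → ℤˣ) →₀ ℚ} :
    x ∈ negEigenspace X ↔ orientationReversal X x = -x := by
  simp [negEigenspace, add_eq_zero_iff_eq_neg]

theorem gradedPiece_neg_card (X : Type) [Fintype X] :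
    gradedPiece X (-(Fintype.card X : ZMod 4)) = posEigenspace X := by
  simp [gradedPiece]

theorem gradedPiece_two_sub_card (X : Type) [Fintype X] :
    gradedPiece X (2 - (Fintype.card X : ZMod 4)) = negEigenspace X := by
  have h : ∀ c : ZMod 4, 2 - c ≠ -c := by decide
  simp [gradedPiece, h]

theorem gradedPiece_cases {X : Type} [Fintype X] {k : ZMod 4} {x : (X → ℤˣ) →₀ ℚ}
    (hx : x ∈ gradedPiece X k) :
    (k = -(Fintype.card X : ZMod 4) ∧ orientationReversal X x = x) ∨
      (k = 2 - (Fintype.card X : ZMod 4) ∧ orientationReversal X x = -x) ∨ x = 0 := by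
  unfold gradedPiece at hx
  split_ifs at hx with h₁ h₂
  · exact Or.inl ⟨h₁, mem_posEigenspace.1 hx⟩
  · exact Or.inr (Or.inl ⟨h₂, mem_negEigenspace.1 hx⟩)
  · exact Or.inr (Or.inr ((Submodule.mem_bot ℚ).1 hx))

theorem stmt_2 (X Y : Type) [Fintype X] [Fintype Y] :
    ∀ i j : ZMod 4,
      Submodule.map (orientationTensorIso X Y).symm.toLinearMap
          (Submodule.map₂ (TensorProduct.mk ℚ ((X → ℤˣ) →₀ ℚ) ((Y → ℤˣ) →₀ ℚ))
            (gradedPiece X i) (gradedPiece Y j))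
        ≤ gradedPiece (X ⊕ Y) (i + j) := by
  intro i j
  rw [Submodule.map_le_iff_le_comap, Submodule.map₂_le]
  intro x hx y hy
  change (orientationTensorIso X Y).symm (x ⊗ₜ[ℚ] y) ∈ gradedPiece (X ⊕ Y) (i + j)
  have hR := orientationReversal_tensorIso_symm X Y x y
  have hcard : (Fintype.card (X ⊕ Y) : ZMod 4) = Fintype.card X + Fintype.card Y := by
    simp
  have hpos : i + j = -(Fintype.card (X ⊕ Y) : ZMod 4) →
      gradedPiece (X ⊕ Y) (i + j) = posEigenspace (X ⊕ Y) := fun h => by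
    rw [h, gradedPiece_neg_card]
  have hneg : i + j = 2 - (Fintype.card (X ⊕ Y) : ZMod 4) →
      gradedPiece (X ⊕ Y) (i + j) = negEigenspace (X ⊕ Y) := fun h => by
    rw [h, gradedPiece_two_sub_card]
  have hfour : (4 : ZMod 4) = 0 := by decide
  rcases gradedPiece_cases hx with ⟨hi, hx'⟩ | ⟨hi, hx'⟩ | rfl
  · rcases gradedPiece_cases hy with ⟨hj, hy'⟩ | ⟨hj, hy'⟩ | rfl
    · rw [hpos (by rw [hi, hj, hcard]; ring), mem_posEigenspace, hR, hx', hy']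
    · rw [hneg (by rw [hi, hj, hcard]; ring), mem_negEigenspace, hR, hx', hy',
        TensorProduct.tmul_neg, map_neg]
    · simp
  · rcases gradedPiece_cases hy with ⟨hj, hy'⟩ | ⟨hj, hy'⟩ | rfl
    · rw [hneg (by rw [hi, hj, hcard]; ring), mem_negEigenspace, hR, hx', hy',
        TensorProduct.neg_tmul, map_neg]
    · rw [hpos (by rw [hi, hj, hcard]; linear_combination hfour), mem_posEigenspace, hR, hx', hy',
        TensorProduct.neg_tmul, TensorProduct.tmul_neg, neg_neg]
    · simp
  · simp
end

section
/- Let X, Y, Z be finite types. Given cobordism data (O_A, σ_A, r_{AX} : O_A → (X → ℤˣ), r_{AY} : O_A → (Y → ℤˣ)) and (O_B, σ_B, r_{BY} : O_B → (Y → ℤˣ), r_{BZ} : O_B → (Z → ℤˣ)) with O_A, O_B finite types and σ_A : O_A → ℤˣ, σ_B : O_B → ℤˣ, the composite F_{(O_B,σ_B,r_{BY},r_{BZ})} ∘ F_{(O_A,σ_A,r_{AX},r_{AY})} : 𝕆(X) → 𝕆(Z) equals F_{(O_C,σ_C,r_{CX},r_{CZ})}, where O_C is the fiber product {(a,b) ∈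 O_A × O_B : r_{AY}(a) = r_{BY}(b)}, σ_C(a,b) = σ_A(a)·σ_B(b), r_{CX}(a,b) = r_{AX}(a), and r_{CZ}(a,b) = r_{BZ}(b). -/
/-- The map `𝕆(X) → 𝕆(Y)` associated to cobordism data `(O, σ, r_X, r_Y)`:
it sends `α` to `∑ o ∈ O, σ(o) ⟨α, r_X(o)⟩ · r_Y(o)`, where `⟨α, r_X(o)⟩` is the
coefficient of the basis vector `r_X(o)` in `α`. -/
noncomputable def cobordismMap {X Y O : Type} [Fintype O] (σ : O → ℤˣ)
    (rX : O → X → ℤˣ) (rY : O → Y → ℤˣ) :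
    ((X → ℤˣ) →₀ ℚ) →ₗ[ℚ] ((Y → ℤˣ) →₀ ℚ) :=
  ∑ o : O, ((σ o : ℤ) : ℚ) • ((Finsupp.lsingle (rY o)).comp (Finsupp.lapply (rX o)))

theorem cobordismMap_apply {X Y O : Type} [Fintype O] (σ : O → ℤˣ)
    (rX : O → X → ℤˣ) (rY : O → Y → ℤˣ) (α : (X → ℤˣ) →₀ ℚ) :
    cobordismMap σ rX rY α
      = ∑ o, Finsupp.single (rY o) (((σ o : ℤ) : ℚ) * α (rX o)) := by
  simp [cobordismMap, LinearMap.sum_apply]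

theorem stmt_3 (X Y Z OA OB : Type) [Fintype X] [Fintype Y] [Fintype Z]
    [Fintype OA] [Fintype OB]
    (σA : OA → ℤˣ) (rAX : OA → X → ℤˣ) (rAY : OA → Y → ℤˣ)
    (σB : OB → ℤˣ) (rBY : OB → Y → ℤˣ) (rBZ : OB → Z → ℤˣ) :
    (cobordismMap σB rBY rBZ).comp (cobordismMap σA rAX rAY)
      = cobordismMap (O := {p : OA × OB // rAY p.1 = rBY p.2})
          (fun p => σA p.1.1 * σB p.1.2)
          (fun p => rAX p.1.1)
          (fun p => rBZ p.1.2) := by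
  classical
  refine LinearMap.ext fun α => ?_
  simp only [LinearMap.comp_apply, cobordismMap_apply, Finsupp.finsetSum_apply,
    Finsupp.single_apply, Finset.mul_sum, Finsupp.single_finsetSum]
  rw [Finset.sum_comm, ← Fintype.sum_prod_type',
    ← Finset.sum_subtype (Finset.univ.filter fun p : OA × OB => rAY p.1 = rBY p.2) (by simp)
      (fun p => Finsupp.single (rBZ p.2)
        (((σA p.1 * σB p.2 : ℤˣ) : ℤ) * α (rAX p.1) : ℚ)),
    Finset.sum_filter]
  refine Finset.sum_congr rfl fun p _ => ?_
  split_ifs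
  · push_cast
    congr 1
    ring
  · simp
end

section
/- Let K be a field, c ∈ K, and a = c². In the Lee algebra V_a = K[w]/(w² − a), set x₊ = w + c and x₋ = w − c. Then: x₊·x₋ = 0, x₊² = 2c·x₊, x₋² = −2c·x₋, Δ(x₊) = x₊ ⊗ x₊, Δ(x₋) = x₋ ⊗ x₋, ε(x₊) = 1, ε(x₋) = 1; and if 2c ≠ 0 then the unit satisfies 1 = (2c)⁻¹·(x₊ − x₋). -/
open Polynomial TensorProduct

/-- The Lee algebra `V_a = K[w]/(w² - a)`. -/
abbrev LeeAlgebra (K : Type) [Field K] (a : K) : Type :=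
  AdjoinRoot ((X : K[X]) ^ 2 - C a)

/-- The class of `w` in the Lee algebra. -/
noncomputable def leeW (K : Type) [Field K] (a : K) : LeeAlgebra K a :=
  AdjoinRoot.root _

theorem leeW_sq (K : Type) [Field K] (a : K) :
    leeW K a ^ 2 = algebraMap K (LeeAlgebra K a) a := by
  have h := AdjoinRoot.eval₂_root ((X : K[X]) ^ 2 - C a)
  rw [eval₂_sub, eval₂_X_pow, eval₂_C] at h
  exact sub_eq_zero.mp h

/-- If `Δ 1 = w ⊗ 1 + 1 ⊗ w` and `Δ w = w ⊗ w + c² (1 ⊗ 1)`, then `w + c` is group-like. -/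
theorem map_add_smul_one_eq_tmul_self {R A : Type*} [CommRing R] [CommRing A] [Algebra R A]
    (Δ : A →ₗ[R] A ⊗[R] A) (w : A) (c : R)
    (hΔ1 : Δ 1 = w ⊗ₜ[R] 1 + 1 ⊗ₜ[R] w)
    (hΔw : Δ w = w ⊗ₜ[R] w + c ^ 2 • ((1 : A) ⊗ₜ[R] 1)) :
    Δ (w + c • 1) = (w + c • 1) ⊗ₜ[R] (w + c • 1) := by
  simp only [map_add, map_smul, hΔ1, hΔw, TensorProduct.add_tmul, TensorProduct.tmul_add,
    ← TensorProduct.smul_tmul', TensorProduct.tmul_smul]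
  module

theorem stmt_9 (K : Type) [Field K] (c a : K) (ha : a = c ^ 2)
    (Δ : LeeAlgebra K a →ₗ[K] LeeAlgebra K a ⊗[K] LeeAlgebra K a)
    (hΔ1 : Δ 1 = leeW K a ⊗ₜ[K] 1 + 1 ⊗ₜ[K] leeW K a)
    (hΔw : Δ (leeW K a) = leeW K a ⊗ₜ[K] leeW K a + a • ((1 : LeeAlgebra K a) ⊗ₜ[K] 1))
    (ε : LeeAlgebra K a →ₗ[K] K) (hε1 : ε 1 = 0) (hεw : ε (leeW K a) = 1)
    (xp xm : LeeAlgebra K a)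
    (hxp : xp = leeW K a + algebraMap K (LeeAlgebra K a) c)
    (hxm : xm = leeW K a - algebraMap K (LeeAlgebra K a) c) :
    xp * xm = 0 ∧
    xp ^ 2 = (2 * c) • xp ∧
    xm ^ 2 = (-(2 * c)) • xm ∧
    Δ xp = xp ⊗ₜ[K] xp ∧
    Δ xm = xm ⊗ₜ[K] xm ∧
    ε xp = 1 ∧
    ε xm = 1 ∧
    (2 * c ≠ 0 → (1 : LeeAlgebra K a) = (2 * c)⁻¹ • (xp - xm)) := by
  subst ha
  have hw := (leeW_sq K (c ^ 2)).trans (map_pow _ c 2)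
  have hxp' : xp = leeW K (c ^ 2) + c • 1 := by rw [hxp, Algebra.algebraMap_eq_smul_one]
  have hxm' : xm = leeW K (c ^ 2) + (-c) • 1 := by
    rw [hxm, Algebra.algebraMap_eq_smul_one, neg_smul, sub_eq_add_neg]
  refine ⟨?_, ?_, ?_, ?_, ?_, ?_, ?_, fun hc => ?_⟩
  · rw [hxp, hxm]
    linear_combination hw
  · rw [Algebra.smul_def, map_mul, map_ofNat, hxp]
    linear_combination hw
  · rw [Algebra.smul_def, map_neg, map_mul, map_ofNat, hxm]
    linear_combination hw
  · rw [hxp']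
    exact map_add_smul_one_eq_tmul_self Δ _ c hΔ1 hΔw
  · rw [hxm']
    exact map_add_smul_one_eq_tmul_self Δ _ (-c) hΔ1 (by rw [neg_sq, hΔw])
  · rw [hxp', map_add, map_smul, hε1, hεw, smul_zero, add_zero]
  · rw [hxm', map_add, map_smul, hε1, hεw, smul_zero, add_zero]
  · have h : xp - xm = (2 * c) • (1 : LeeAlgebra K (c ^ 2)) := by
      rw [hxp', hxm']
      module
    rw [h, inv_smul_smul₀ hc]
end
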